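/- (Exponential integrability implies lower mass bound, case p = s.) Let (X,d,μ) be a uniformly perfect metric-measure space with constant λ ∈ (0,1/5), and fix s ∈ (0,∞), σ ≥ 1. Suppose there exist C_1, C_2, γ ∈ (0,∞) such that ⨍_{B_0} exp( C_1 |u−u_{B_0}| / ‖g‖_{L^s(σB_0,μ)} )^γ dμ ≤ C_2 whenever B_0 ⊆ X is a ball with radius at most diam(X), u ∈ M^{1,s}(σB_0,d,μ), and g ∈ D_+(u). Then there exists κ ∈ (0,∞), explicitly κ = C_1^s λ^{2s} / (96^s (2s/γ)^{s/γ} √C_2), such that μ(B(x,r)) ≥ κ r^s for every x ∈ X and every finite r ∈ (0, diam(X)]. -/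

import Mathlib

open Metric MeasureTheory Set

/-- The "half-measure radius" function `φ_x(r)`. -/
noncomputable def phi {X : Type*} [MetricSpace X] [MeasurableSpace X]
    (μ : Measure X) (x : X) (r : ℝ) : ℝ :=
  sSup {s : ℝ | s ∈ Icc 0 r ∧ μ (ball x s) ≤ μ (ball x r) / 2}

/-- `g` is a Hajłasz gradient of `u` on `Ω`. -/
def HajlaszGrad {X : Type*} [MetricSpace X] [MeasurableSpace X]
    (μ : Measure X) (Ω : Set X) (u g : X → ℝ) : Prop :=
  (∀ z, 0 ≤ g z) ∧ ∃ N : Set X, μ N = 0 ∧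
    ∀ z ∈ Ω \ N, ∀ w ∈ Ω \ N, |u z - u w| ≤ dist z w * (g z + g w)

/-- `f ∈ L^p(Ω, μ)`. -/
def MemLpOn {X : Type*} [MetricSpace X] [MeasurableSpace X]
    (μ : Measure X) (Ω : Set X) (f : X → ℝ) (p : ℝ) : Prop :=
  ∫⁻ z in Ω, ENNReal.ofReal (|f z| ^ p) ∂μ < ⊤

/-- The `L^s(Ω,μ)` norm of `g`, as a real number. -/
noncomputable def LsNorm {X : Type*} [MetricSpace X] [MeasurableSpace X]
    (μ : Measure X) (Ω : Set X) (g : X → ℝ) (s : ℝ) : ℝ :=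
  ((∫⁻ z in Ω, ENNReal.ofReal (|g z| ^ s) ∂μ) ^ (1 / s)).toReal

theorem iter_aux (m : ℕ → ℝ) (D b c : ℝ) (hD : 0 < D) (hb : 1 < b) (hc : 0 < c)
    (hm : ∀ j, c ≤ m j) (h : ∀ j, m (j+1) ≤ D * b ^ j * m j ^ 2) : 1 ≤ D * b * m 0 := by
  by_contra hlt
  push Not at hlt
  have hb0 : 0 < b := by linarith
  have hn : ∀ j, D * b ^ (j+1) * m j < 1 := by
    intro j
    induction j with
    | zero => simpa using hlt
    | succ j ih =>
      have hpos : 0 ≤ D * b ^ (j+1) * m j := by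
        have := hc.le.trans (hm j)
        positivity
      calc D * b ^ (j+1+1) * m (j+1) ≤ D * b ^ (j+1+1) * (D * b ^ j * m j ^ 2) := by
            gcongr; exact h j
        _ = (D * b ^ (j+1) * m j) ^ 2 := by ring
        _ < 1 := by nlinarith
  obtain ⟨n, hn'⟩ := pow_unbounded_of_one_lt (1 / (D * c)) hb
  have h1 := hn n
  have h2 : b ^ n ≤ b ^ (n+1) := pow_le_pow_right₀ hb.le (by omega)
  have h3 : 1 < b ^ n * (D * c) := by
    rwa [div_lt_iff₀ (by positivity)] at hn'
  have h4 : b ^ n * (D * c) ≤ D * b ^ (n+1) * m n := by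
    calc b ^ n * (D * c) ≤ b ^ (n+1) * (D * m n) := by
          gcongr; exact hm n
      _ = _ := by ring
  linarith

theorem real_step {s C₁ C₂ γ M mt mr e : ℝ} (hs : 0 < s)
    (hC₁ : 0 < C₁) (hC₂ : 0 < C₂) (hγ : 0 < γ) (hM : 0 < M) (hmt : 0 < mt) (hmr : 0 < mr)
    (he : 0 < e)
    (h : mt * Real.exp ((C₁ * (1/2) / (mr ^ (1/s) / e)) ^ γ) ≤ C₂ * M) :
    mt ≤ (2*s/γ) ^ (2*s/γ) * C₂ * M * 2 ^ (2*s) / C₁ ^ (2*s) / e ^ (2*s) * mr ^ 2 := by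
  set Y := C₁ * (1/2) / (mr ^ (1/s) / e) with hY
  have hYpos : 0 < Y := by positivity
  have h1 : Real.exp (Y ^ γ) ≤ C₂ * M / mt := by
    rw [le_div_iff₀ hmt]; linarith
  have hZ : 0 < C₂ * M / mt := by positivity
  have h2 : Y ^ γ ≤ Real.log (C₂ * M / mt) := by
    rwa [Real.le_log_iff_exp_le hZ]
  have h3 : Y ^ γ ≤ (C₂ * M / mt) ^ (γ/(2*s)) / (γ/(2*s)) :=
    h2.trans (Real.log_le_rpow_div hZ.le (by positivity))
  have h4 : (Y ^ γ) ^ (2*s/γ) ≤ ((C₂ * M / mt) ^ (γ/(2*s)) / (γ/(2*s))) ^ (2*s/γ) :=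
    Real.rpow_le_rpow (by positivity) h3 (by positivity)
  have e1 : (Y ^ γ) ^ (2*s/γ) = Y ^ (2*s) := by
    rw [← Real.rpow_mul hYpos.le]; congr 1; field_simp
  have e2 : ((C₂ * M / mt) ^ (γ/(2*s)) / (γ/(2*s))) ^ (2*s/γ)
      = (C₂ * M / mt) * (2*s/γ) ^ (2*s/γ) := by
    rw [div_eq_mul_inv, inv_div, Real.mul_rpow (by positivity) (by positivity),
      ← Real.rpow_mul hZ.le]
    have : γ/(2*s) * (2*s/γ) = 1 := by field_simp
    rw [this, Real.rpow_one]
  have e3 : Y ^ (2*s) = C₁ ^ (2*s) * e ^ (2*s) / (2 ^ (2*s) * mr ^ 2) := by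
    have : Y = (C₁ * e) / (2 * mr ^ (1/s)) := by rw [hY]; field_simp
    rw [this, Real.div_rpow (by positivity) (by positivity),
      Real.mul_rpow (by positivity) (by positivity),
      Real.mul_rpow (by positivity) (by positivity), ← Real.rpow_mul hmr.le]
    have : 1/s * (2*s) = (2:ℕ) := by field_simp; norm_num
    rw [this, Real.rpow_natCast]
  rw [e1, e2, e3] at h4
  have hp1 : 0 < C₁ ^ (2*s) := by positivity
  have hp2 : 0 < e ^ (2*s) := by positivity
  have hp3 : (0:ℝ) < 2 ^ (2*s) := by positivity
  have hp4 : 0 < (2*s/γ) ^ (2*s/γ) := by positivity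
  generalize C₁ ^ (2*s) = c1 at *
  generalize e ^ (2*s) = ee at *
  generalize (2:ℝ) ^ (2*s) = tt at *
  generalize (2*s/γ) ^ (2*s/γ) = qq at *
  rw [div_mul_eq_mul_div, div_le_div_iff₀ (by positivity) (by positivity)] at h4
  rw [div_div, div_mul_eq_mul_div, le_div_iff₀ (by positivity)]
  linarith

theorem real_final {s C₁ C₂ γ M a : ℝ} (hs : 0 < s)
    (hC₁ : 0 < C₁) (hC₂ : 0 < C₂) (hγ : 0 < γ) (hM : 0 < M) (ha : 0 < a)
    (h : 1 ≤ ((2*s/γ) ^ (2*s/γ) * C₂ * M * 2 ^ (2*s) / C₁ ^ (2*s) / (a/4) ^ (2*s)) * 2 ^ (2*s) * M) :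
    C₁ ^ s * a ^ s / (16 ^ s * (2 * s / γ) ^ (s / γ) * Real.sqrt C₂) ≤ M := by
  have q1 : ∀ y : ℝ, 0 < y → y ^ (2*s) = (y ^ s) ^ 2 := by
    intro y hy
    rw [← Real.rpow_natCast, ← Real.rpow_mul hy.le]; congr 1; push_cast; ring
  have q2 : (2*s/γ) ^ (2*s/γ) = ((2*s/γ) ^ (s/γ)) ^ 2 := by
    rw [← Real.rpow_natCast, ← Real.rpow_mul (by positivity)]; congr 1; push_cast; ring
  have q3 : C₂ = Real.sqrt C₂ ^ 2 := (Real.sq_sqrt hC₂.le).symm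
  have q4 : (16:ℝ) ^ s = 2 ^ s * 2 ^ s * 4 ^ s := by
    rw [← Real.mul_rpow, ← Real.mul_rpow] <;> norm_num
  have q5 : 0 < Real.sqrt C₂ := Real.sqrt_pos.2 hC₂
  rw [q1 _ hC₁, q1 2 (by norm_num), q1 (a/4) (by positivity), q2,
    Real.div_rpow ha.le (by norm_num)] at h
  nth_rewrite 1 [q3] at h
  rw [q4]
  have hp1 : 0 < C₁ ^ s := by positivity
  have hp2 : 0 < a ^ s := by positivity
  have hp3 : (0:ℝ) < 2 ^ s := by positivity
  have hp5 : (0:ℝ) < 4 ^ s := by positivity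
  have hp4 : 0 < (2*s/γ) ^ (s/γ) := by positivity
  generalize C₁ ^ s = c1 at *
  generalize a ^ s = ee at *
  generalize (2:ℝ) ^ s = tt at *
  generalize (4:ℝ) ^ s = ff at *
  generalize (2*s/γ) ^ (s/γ) = qq at *
  generalize Real.sqrt C₂ = w at *
  rw [div_le_iff₀ (by positivity)]
  have h' : 1 ≤ (M * (tt * tt * ff * qq * w) / (c1 * ee)) ^ 2 := by
    convert h using 1
    field_simp
  have h2 : 1 ≤ M * (tt * tt * ff * qq * w) / (c1 * ee) := by
    rw [one_le_sq_iff₀ (by positivity)] at h'; exact h'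
  rwa [le_div_iff₀ (by positivity), one_mul] at h2

theorem cutoff_step {X : Type*} [MetricSpace X] [MeasurableSpace X] [BorelSpace X]
    (μ : Measure X)
    (hμ : ∀ (x : X) (r : ℝ), 0 < r → 0 < μ (ball x r) ∧ μ (ball x r) < ⊤)
    {s σ C₁ C₂ γ : ℝ} (hs : 0 < s) (hσ : 1 ≤ σ)
    (hC₁ : 0 < C₁) (hC₂ : 0 < C₂) (hγ : 0 < γ)
    (x : X) (R a t ρ : ℝ) (hR : 0 < R) (haR : a ≤ R)
    (hT : ∀ u g : X → ℝ, HajlaszGrad μ (ball x (σ * R)) u g →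
        MemLpOn μ (ball x (σ * R)) u s → MemLpOn μ (ball x (σ * R)) g s →
        0 < LsNorm μ (ball x (σ * R)) g s →
        (μ (ball x R))⁻¹ *
            ∫⁻ z in ball x R,
              ENNReal.ofReal (Real.exp
                ((C₁ * |u z - ⨍ w in ball x R, u w ∂μ| /
                    LsNorm μ (ball x (σ * R)) g s) ^ γ)) ∂μ ≤
          ENNReal.ofReal C₂)
    (hhalf : μ (ball x a) ≤ μ (ball x R) / 2)
    (ht : 0 < t) (htρ : t < ρ) (hρ : ρ ≤ a) :
    μ.real (ball x t) * Real.exp ((C₁ * (1/2) / (μ.real (ball x ρ) ^ (1/s) / (ρ - t))) ^ γ)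
      ≤ C₂ * μ.real (ball x R) := by
  have he : 0 < ρ - t := by linarith
  have hρ0 : 0 < ρ := by linarith
  have hRσ : R ≤ σ * R := by nlinarith
  have fin : ∀ r, μ (ball x r) ≠ ⊤ := fun r => by
    rcases le_or_gt r 0 with h | h
    · simp [ball_eq_empty.2 h]
    · exact (hμ x r h).2.ne
  set u : X → ℝ := fun z => max 0 (min 1 ((ρ - dist z x) / (ρ - t))) with hu
  set g : X → ℝ := (ball x ρ).indicator (fun _ => (ρ - t)⁻¹) with hg
  have hu0 : ∀ z, 0 ≤ u z := fun z => le_max_left _ _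
  have hu1 : ∀ z, u z ≤ 1 := fun z => max_le zero_le_one (min_le_left _ _)
  have hg0 : ∀ z, 0 ≤ g z := fun z => indicator_nonneg (fun _ _ => by positivity) z
  have hin : ∀ z ∈ ball x ρ, g z = (ρ - t)⁻¹ := fun z hz => indicator_of_mem hz _
  have hzero : ∀ z, z ∉ ball x ρ → u z = 0 := by
    intro z hz
    rw [mem_ball, not_lt] at hz
    have : (ρ - dist z x) / (ρ - t) ≤ 0 := div_nonpos_of_nonpos_of_nonneg (by linarith) he.le
    exact max_eq_left ((min_le_right _ _).trans this)
  have hone : ∀ z ∈ ball x t, u z = 1 := by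
    intro z hz
    rw [mem_ball] at hz
    have : 1 ≤ (ρ - dist z x) / (ρ - t) := by rw [le_div_iff₀ he]; linarith
    simp [hu, min_eq_left this]
  have hlip : ∀ z w, |u z - u w| ≤ dist z w * (ρ - t)⁻¹ := by
    intro z w
    have h1 : |u z - u w| ≤ |(ρ - dist z x) / (ρ - t) - (ρ - dist w x) / (ρ - t)| := by
      have h2 : |u z - u w| ≤ |min 1 ((ρ - dist z x) / (ρ - t)) - min 1 ((ρ - dist w x) / (ρ - t))| := by
        simp only [hu]
        refine (abs_max_sub_max_le_max _ _ _ _).trans ?_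
        simp
      refine h2.trans ((abs_min_sub_min_le_max _ _ _ _).trans ?_)
      simp
    refine h1.trans ?_
    rw [← sub_div, abs_div, abs_of_pos he, div_eq_mul_inv]
    gcongr
    have := abs_dist_sub_le w z x
    rw [dist_comm w z] at this
    have e : ρ - dist z x - (ρ - dist w x) = dist w x - dist z x := by ring
    rwa [e]
  have hgrad : HajlaszGrad μ (ball x (σ * R)) u g := by
    refine ⟨hg0, ∅, by simp, ?_⟩
    intro z _ w _
    by_cases hz : z ∈ ball x ρ
    · refine (hlip z w).trans ?_
      gcongr
      rw [hin z hz]; linarith [hg0 w]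
    by_cases hw : w ∈ ball x ρ
    · refine (hlip z w).trans ?_
      gcongr
      rw [hin w hw]; linarith [hg0 z]
    · rw [hzero z hz, hzero w hw, sub_zero, abs_zero]
      have := hg0 z; have := hg0 w; positivity
  have hmu : MemLpOn μ (ball x (σ * R)) u s := by
    unfold MemLpOn
    calc _ ≤ ∫⁻ z in ball x (σ * R), 1 ∂μ := by
          apply lintegral_mono
          intro z
          simp only [ENNReal.ofReal_le_one]
          apply Real.rpow_le_one (abs_nonneg _) _ hs.le
          rw [abs_of_nonneg (hu0 z)]; exact hu1 z
      _ < ⊤ := by simpa using (fin _).lt_top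
  have hgInt : ∫⁻ z in ball x (σ * R), ENNReal.ofReal (|g z| ^ s) ∂μ
      = ENNReal.ofReal (((ρ - t)⁻¹) ^ s) * μ (ball x ρ) := by
    have : (fun z => ENNReal.ofReal (|g z| ^ s))
        = (ball x ρ).indicator (fun _ => ENNReal.ofReal (((ρ - t)⁻¹) ^ s)) := by
      funext z
      by_cases hz : z ∈ ball x ρ
      · rw [indicator_of_mem hz, hin z hz, abs_of_pos (by positivity)]
      · rw [indicator_of_notMem hz, hg, indicator_of_notMem hz]
        simp [Real.zero_rpow hs.ne']
    rw [this, lintegral_indicator measurableSet_ball, lintegral_const,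
      Measure.restrict_restrict measurableSet_ball, Measure.restrict_apply MeasurableSet.univ,
      univ_inter, inter_eq_left.2 (ball_subset_ball (by linarith))]
  have hmg : MemLpOn μ (ball x (σ * R)) g s := by
    unfold MemLpOn
    rw [hgInt]
    exact ENNReal.mul_lt_top ENNReal.ofReal_lt_top (fin _).lt_top
  have mpos : ∀ r, 0 < r → 0 < μ.real (ball x r) := fun r hr =>
    ENNReal.toReal_pos (hμ x r hr).1.ne' (fin r)
  have hnorm : LsNorm μ (ball x (σ * R)) g s = μ.real (ball x ρ) ^ (1/s) / (ρ - t) := by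
    unfold LsNorm
    rw [hgInt, ← ENNReal.toReal_rpow, ENNReal.toReal_mul, ENNReal.toReal_ofReal (by positivity),
      Real.mul_rpow (by positivity) (by positivity), ← Real.rpow_mul (by positivity),
      mul_one_div_cancel hs.ne', Real.rpow_one, div_eq_mul_inv, mul_comm]
    rfl
  have hmρ := mpos ρ hρ0
  have hnpos : 0 < LsNorm μ (ball x (σ * R)) g s := by rw [hnorm]; positivity
  have key := hT u g hgrad hmu hmg hnpos
  rw [hnorm] at key
  set c := ⨍ w in ball x R, u w ∂μ with hc
  set L := μ.real (ball x ρ) ^ (1/s) / (ρ - t) with hL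
  have hLpos : 0 < L := by positivity
  set E := Real.exp ((C₁ * (1/2) / L) ^ γ) with hE
  -- a good set
  obtain ⟨S, hSm, hSR, hSμ, hS⟩ : ∃ S : Set X, MeasurableSet S ∧ S ⊆ ball x R ∧
      μ (ball x t) ≤ μ S ∧ ∀ z ∈ S, 1/2 ≤ |u z - c| := by
    rcases le_or_gt c (1/2) with h | h
    · refine ⟨ball x t, measurableSet_ball, ball_subset_ball (by linarith), le_rfl, ?_⟩
      intro z hz
      rw [hone z hz]
      exact le_trans (by linarith) (le_abs_self _)
    · refine ⟨ball x R \ ball x ρ, measurableSet_ball.diff measurableSet_ball, sdiff_subset, ?_, ?_⟩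
      · have h1 : μ (ball x t) ≤ μ (ball x R) / 2 :=
          (measure_mono (ball_subset_ball (by linarith))).trans hhalf
        have h2 : μ (ball x ρ) ≤ μ (ball x R) / 2 :=
          (measure_mono (ball_subset_ball (by linarith))).trans hhalf
        rw [measure_sdiff (ball_subset_ball (by linarith)) measurableSet_ball.nullMeasurableSet (fin _)]
        refine h1.trans (ENNReal.le_sub_of_add_le_right (fin _) ?_)
        calc _ ≤ μ (ball x R) / 2 + μ (ball x R) / 2 := by gcongr
          _ = _ := ENNReal.add_halves _
      · intro z hz
        rw [hzero z hz.2, zero_sub, abs_neg]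
        exact le_trans h.le (le_abs_self _)
  have low : ENNReal.ofReal E * μ (ball x t) ≤ ∫⁻ z in ball x R,
      ENNReal.ofReal (Real.exp ((C₁ * |u z - c| / L) ^ γ)) ∂μ := by
    calc ENNReal.ofReal E * μ (ball x t) ≤ ENNReal.ofReal E * μ S := by gcongr
      _ = ∫⁻ z in S, ENNReal.ofReal E ∂μ := by simp
      _ ≤ ∫⁻ z in S, ENNReal.ofReal (Real.exp ((C₁ * |u z - c| / L) ^ γ)) ∂μ := by
          apply setLIntegral_mono' hSm
          intro z hz
          apply ENNReal.ofReal_le_ofReal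
          apply Real.exp_le_exp.2
          apply Real.rpow_le_rpow (by positivity) _ hγ.le
          have := hS z hz
          gcongr
      _ ≤ _ := lintegral_mono_set hSR
  have h3 : ENNReal.ofReal E * μ (ball x t) ≤ ENNReal.ofReal C₂ * μ (ball x R) := by
    refine low.trans ?_
    rw [mul_comm, ← div_eq_mul_inv] at key
    rwa [ENNReal.div_le_iff (hμ x R hR).1.ne' (fin R)] at key
  have h4 := ENNReal.toReal_mono (ENNReal.mul_ne_top ENNReal.ofReal_ne_top (fin R)) h3
  rw [ENNReal.toReal_mul, ENNReal.toReal_mul, ENNReal.toReal_ofReal (Real.exp_pos _).le,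
    ENNReal.toReal_ofReal hC₂.le] at h4
  rw [mul_comm]
  exact h4

theorem core_bound {X : Type*} [MetricSpace X] [MeasurableSpace X] [BorelSpace X]
    (μ : Measure X)
    (hμ : ∀ (x : X) (r : ℝ), 0 < r → 0 < μ (ball x r) ∧ μ (ball x r) < ⊤)
    {s σ C₁ C₂ γ : ℝ} (hs : 0 < s) (hσ : 1 ≤ σ)
    (hC₁ : 0 < C₁) (hC₂ : 0 < C₂) (hγ : 0 < γ)
    (x : X) (R a : ℝ) (ha : 0 < a) (haR : a ≤ R)
    (hT : ∀ u g : X → ℝ, HajlaszGrad μ (ball x (σ * R)) u g →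
        MemLpOn μ (ball x (σ * R)) u s → MemLpOn μ (ball x (σ * R)) g s →
        0 < LsNorm μ (ball x (σ * R)) g s →
        (μ (ball x R))⁻¹ *
            ∫⁻ z in ball x R,
              ENNReal.ofReal (Real.exp
                ((C₁ * |u z - ⨍ w in ball x R, u w ∂μ| /
                    LsNorm μ (ball x (σ * R)) g s) ^ γ)) ∂μ ≤
          ENNReal.ofReal C₂)
    (hhalf : μ (ball x a) ≤ μ (ball x R) / 2) :
    ENNReal.ofReal (C₁ ^ s * a ^ s / (16 ^ s * (2 * s / γ) ^ (s / γ) * Real.sqrt C₂))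
      ≤ μ (ball x R) := by
  have hR : 0 < R := by linarith
  have mpos : ∀ r, 0 < r → 0 < μ.real (ball x r) := fun r hr =>
    ENNReal.toReal_pos (hμ x r hr).1.ne' (hμ x r hr).2.ne
  have mmono : ∀ r r', r ≤ r' → 0 < r' → μ.real (ball x r) ≤ μ.real (ball x r') :=
    fun r r' h h' => ENNReal.toReal_mono (hμ x r' h').2.ne (measure_mono (ball_subset_ball h))
  have hM := mpos R hR
  set M := μ.real (ball x R) with hMdef
  refine ENNReal.ofReal_le_of_le_toReal ?_
  change _ ≤ M
  set rr : ℕ → ℝ := fun j => ((1/2)^(j+1) + 1/2) * a with hrr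
  have hb : (1:ℝ) < 2 ^ (2*s) := Real.one_lt_rpow (by norm_num) (by positivity)
  set D := (2*s/γ) ^ (2*s/γ) * C₂ * M * 2 ^ (2*s) / C₁ ^ (2*s) / (a/4) ^ (2*s) with hDdef
  have hD : 0 < D := by positivity
  have hrlow : ∀ j, a/2 ≤ rr j := by
    intro j
    have : (0:ℝ) < (1/2)^(j+1) := by positivity
    simp only [hrr]; nlinarith
  have hrup : ∀ j, rr j ≤ a := by
    intro j
    have : ((1:ℝ)/2)^(j+1) ≤ 1/2 := by
      rw [pow_succ]
      have : ((1:ℝ)/2)^j ≤ 1 := pow_le_one₀ (by norm_num) (by norm_num)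
      linarith
    simp only [hrr]; nlinarith
  have hdiff : ∀ j, rr j - rr (j+1) = (a/4) * (1/2)^j := by
    intro j; simp only [hrr]; ring
  have hit := iter_aux (fun j => μ.real (ball x (rr j))) D (2 ^ (2*s)) (μ.real (ball x (a/2)))
    hD hb (mpos _ (by positivity))
    (fun j => mmono _ _ (hrlow j) (by linarith [hrlow j])) (by
      intro j
      have hd : 0 < rr j - rr (j+1) := by rw [hdiff]; positivity
      have h1 := cutoff_step μ hμ hs hσ hC₁ hC₂ hγ x R a (rr (j+1)) (rr j) hR haR hT hhalf
        (by linarith [hrlow (j+1)]) (by linarith) (hrup j)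
      have h2 := real_step hs hC₁ hC₂ hγ hM (mpos _ (by linarith [hrlow (j+1)]))
        (mpos _ (by linarith [hrlow j])) hd h1
      refine h2.trans (le_of_eq ?_)
      have e1 : (rr j - rr (j+1)) ^ (2*s) = (a/4) ^ (2*s) / (2 ^ (2*s)) ^ j := by
        rw [hdiff, Real.mul_rpow (by positivity) (by positivity), div_eq_mul_inv]
        congr 1
        rw [← Real.rpow_natCast, ← Real.rpow_natCast, ← Real.rpow_mul (by norm_num),
          ← Real.rpow_mul (by norm_num), one_div, Real.inv_rpow (by norm_num), mul_comm]
      rw [e1, hDdef]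
      have : (0:ℝ) < (2 ^ (2*s)) ^ j := by positivity
      have : (0:ℝ) < (a/4) ^ (2*s) := by positivity
      field_simp)
  apply real_final hs hC₁ hC₂ hγ hM ha
  refine hit.trans ?_
  gcongr
  exact mmono _ _ ((hrup 0).trans haR) hR

theorem stmt12 {X : Type*} [MetricSpace X] [MeasurableSpace X] [BorelSpace X]
    (μ : Measure X)
    (hμ : ∀ (x : X) (r : ℝ), 0 < r → 0 < μ (ball x r) ∧ μ (ball x r) < ⊤)
    {lam : ℝ} (hlam0 : 0 < lam) (hlam : lam < 1 / 5)
    (hup : ∀ (x : X) (r : ℝ), 0 < r → ball x r ≠ univ →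
      (ball x r \ ball x (lam * r)).Nonempty)
    {s σ C₁ C₂ γ : ℝ} (hs : 0 < s) (hσ : 1 ≤ σ)
    (hC₁ : 0 < C₁) (hC₂ : 0 < C₂) (hγ : 0 < γ)
    (hTrud : ∀ (x₀ : X) (R₀ : ℝ), 0 < R₀ →
      ENNReal.ofReal R₀ ≤ EMetric.diam (univ : Set X) →
      ∀ u g : X → ℝ, HajlaszGrad μ (ball x₀ (σ * R₀)) u g →
        MemLpOn μ (ball x₀ (σ * R₀)) u s → MemLpOn μ (ball x₀ (σ * R₀)) g s →
        0 < LsNorm μ (ball x₀ (σ * R₀)) g s →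
        (μ (ball x₀ R₀))⁻¹ *
            ∫⁻ z in ball x₀ R₀,
              ENNReal.ofReal (Real.exp
                ((C₁ * |u z - ⨍ w in ball x₀ R₀, u w ∂μ| /
                    LsNorm μ (ball x₀ (σ * R₀)) g s) ^ γ)) ∂μ ≤
          ENNReal.ofReal C₂) :
    ∀ (x : X) (r : ℝ), 0 < r → ENNReal.ofReal r ≤ EMetric.diam (univ : Set X) →
      ENNReal.ofReal
          (C₁ ^ s * lam ^ (2 * s) / (96 ^ s * (2 * s / γ) ^ (s / γ) * Real.sqrt C₂) *
            r ^ s) ≤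
        μ (ball x r) := by
  intro x r hr hrd
  set K := 16 ^ s * (2 * s / γ) ^ (s / γ) * Real.sqrt C₂ with hK
  have hKpos : 0 < K := by
    have := Real.sqrt_pos.2 hC₂
    positivity
  have hl2 : lam ^ 2 < 1 / 25 := by nlinarith
  have hl2pos : 0 < lam ^ 2 := by positivity
  have hconst : C₁ ^ s * lam ^ (2 * s) / (96 ^ s * (2 * s / γ) ^ (s / γ) * Real.sqrt C₂) * r ^ s
      = C₁ ^ s * (lam ^ 2 * r / 6) ^ s / K := by
    have e1 : (96:ℝ) ^ s = 16 ^ s * 6 ^ s := by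
      rw [← Real.mul_rpow] <;> norm_num
    have e2 : lam ^ (2 * s) = (lam ^ 2) ^ s := by
      rw [← Real.rpow_natCast, ← Real.rpow_mul hlam0.le]; norm_num
    rw [e1, e2, Real.div_rpow (x := lam ^ 2 * r) (by positivity) (by norm_num),
      Real.mul_rpow (by positivity) hr.le, hK]
    have := Real.sqrt_pos.2 hC₂
    field_simp
  rw [hconst]
  rcases le_or_gt (μ (ball x (lam ^ 2 * r / 3))) (μ (ball x r) / 2) with hc | hc
  · refine le_trans ?_ (core_bound μ hμ hs hσ hC₁ hC₂ hγ x r (lam ^ 2 * r / 3) (by positivity)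
      (by nlinarith) (hTrud x r hr hrd) hc)
    apply ENNReal.ofReal_le_ofReal
    have h0 : 0 < lam ^ 2 * r := by positivity
    have : (lam ^ 2 * r / 6) ^ s ≤ (lam ^ 2 * r / 3) ^ s :=
      Real.rpow_le_rpow (by positivity) (by linarith) hs.le
    rw [← hK]
    gcongr
  · set a := lam ^ 2 * r / 3 with ha
    have ha0 : 0 < a := by positivity
    have har : a ≤ r / 75 := by rw [ha]; nlinarith
    have hal : a ≤ lam * r / 15 := by rw [ha]; nlinarith [mul_pos hlam0 hr]
    have hne : ball x (r/2 - a) ≠ univ := by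
      intro h
      have h1 : EMetric.diam (univ : Set X) ≤ ENNReal.ofReal (2 * (r/2 - a)) := by
        rw [← h]
        refine EMetric.diam_le fun y hy z hz => ?_
        rw [edist_dist]
        apply ENNReal.ofReal_le_ofReal
        rw [mem_ball] at hy hz
        linarith [dist_triangle_right y z x]
      have h2 := hrd.trans h1
      rw [ENNReal.ofReal_le_ofReal_iff (by linarith)] at h2
      linarith
    obtain ⟨y, hy1, hy2⟩ := hup x (r/2 - a) (by linarith) hne
    rw [mem_ball] at hy1
    rw [mem_ball, not_lt] at hy2
    have hsub : ball y (r/2) ⊆ ball x r := ball_subset_ball' (by linarith)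
    have hsub2 : ball x a ⊆ ball y (r/2) := ball_subset_ball' (by rw [dist_comm]; linarith)
    have hlow : lam ^ 2 * r / 6 + a ≤ dist y x := by
      refine le_trans ?_ hy2
      have : lam ^ 2 * r / 6 = a / 2 := by rw [ha]; ring
      rw [this]
      nlinarith [mul_pos hlam0 hr]
    have hdisj : Disjoint (ball y (lam ^ 2 * r / 6)) (ball x a) := ball_disjoint_ball hlow
    have hsub3 : ball y (lam ^ 2 * r / 6) ⊆ ball y (r/2) := ball_subset_ball (by nlinarith)
    have hfin : μ (ball x r) ≠ ⊤ := (hμ x r hr).2.ne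
    have hhalf : μ (ball y (lam ^ 2 * r / 6)) ≤ μ (ball y (r/2)) / 2 := by
      have h1 : μ (ball y (lam ^ 2 * r / 6)) + μ (ball x a) ≤ μ (ball y (r/2)) := by
        rw [← measure_union hdisj measurableSet_ball]
        exact measure_mono (union_subset hsub3 hsub2)
      have h2 : μ (ball y (r/2)) / 2 ≤ μ (ball x a) :=
        (ENNReal.div_le_div_right (measure_mono hsub) 2).trans hc.le
      have h3 : μ (ball y (lam ^ 2 * r / 6)) + μ (ball y (r/2)) / 2
          ≤ μ (ball y (r/2)) / 2 + μ (ball y (r/2)) / 2 := by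
        rw [ENNReal.add_halves]
        exact (add_le_add le_rfl h2).trans h1
      refine (ENNReal.add_le_add_iff_right ?_).1 h3
      exact ne_top_of_le_ne_top hfin ((ENNReal.half_le_self).trans (measure_mono hsub))
    refine le_trans ?_ (measure_mono hsub)
    exact core_bound μ hμ hs hσ hC₁ hC₂ hγ y (r/2) (lam ^ 2 * r / 6) (by positivity)
      (by nlinarith) (hTrud y (r/2) (by positivity)
        ((ENNReal.ofReal_le_ofReal (by linarith)).trans hrd)) hhalf
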